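/- arXiv:2311.07219 — 2 statements merged into one kernel-verified Lean document; each statement's English description precedes it below -/
import Mathlib

section
/- Let G = (V,E) be a finite simple graph with a co-comparability ordering ≺. Let u, v ∈ V be distinct vertices with uv ∉ E, let I_u be a maximum independent set of G containing u and let I_v be a maximum independent set of G containing v. Then pos_{I_u}(u) < pos_{I_v}(v) if and only if u ≺ v. -/
/-- An independent set (as a finset): pairwise non-adjacent vertices. -/
def IsIndep {V : Type*} (G : SimpleGraph V) (I : Finset V) : Prop :=
  ∀ u ∈ I, ∀ v ∈ I, u ≠ v → ¬ G.Adj u v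

/-- The independence number `α(G)`: the maximum size of an independent set. -/
noncomputable def indepNum {V : Type*} (G : SimpleGraph V) : ℕ :=
  sSup {n | ∃ I : Finset V, IsIndep G I ∧ I.card = n}

/-- `pos_I(v) = |{u ∈ I : u ≺ v}| + 1`. -/
def posIn {V : Type*} [LinearOrder V] (I : Finset V) (v : V) : ℕ :=
  (I.filter fun u => u < v).card + 1

/-- In a finite type, no independent set has more than `indepNum G` elements. -/
theorem IsIndep.card_le_indepNum {V : Type*} [Fintype V] {G : SimpleGraph V} {I : Finset V}
    (hI : IsIndep G I) : I.card ≤ indepNum G := by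
  refine le_csSup ⟨Fintype.card V, ?_⟩ ⟨I, hI, rfl⟩
  rintro n ⟨J, -, rfl⟩
  exact J.card_le_univ

/-- The part of `I` up to `u` and the part of `J` from `v` on form an independent set. -/
theorem IsIndep.union_filter {V : Type*} [LinearOrder V] {G : SimpleGraph V}
    (hco : ∀ u v w : V, u < v → v < w → ¬ G.Adj u v → ¬ G.Adj v w → ¬ G.Adj u w)
    {u v : V} (huv : u < v) (hnadj : ¬ G.Adj u v) {I J : Finset V}
    (hI : IsIndep G I) (hu : u ∈ I) (hJ : IsIndep G J) (hv : v ∈ J) :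
    IsIndep G (I.filter (· ≤ u) ∪ J.filter (v ≤ ·)) := by
  have cross : ∀ x ∈ I, x ≤ u → ∀ y ∈ J, v ≤ y → ¬ G.Adj x y := by
    intro x hx hxu y hy hvy
    have hxv : ¬ G.Adj x v := by
      rcases hxu.eq_or_lt with rfl | h
      · exact hnadj
      · exact hco x u v h huv (hI x hx u hu h.ne) hnadj
    rcases hvy.eq_or_lt with rfl | h
    · exact hxv
    · exact hco x v y (hxu.trans_lt huv) h hxv (hJ v hv y hy h.ne)
  intro x hx y hy hxy
  simp only [Finset.mem_union, Finset.mem_filter] at hx hy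
  rcases hx with ⟨hx, hxu⟩ | ⟨hx, hvx⟩ <;> rcases hy with ⟨hy, hyu⟩ | ⟨hy, hvy⟩
  · exact hI x hx y hy hxy
  · exact cross x hx hxu y hy hvy
  · exact fun h => cross y hy hyu x hx hvx h.symm
  · exact hJ x hx y hy hxy

theorem card_filter_le_eq_posIn {V : Type*} [LinearOrder V] {I : Finset V} {u : V} (hu : u ∈ I) :
    (I.filter (· ≤ u)).card = posIn I u := by
  have h : I.filter (· ≤ u) = insert u (I.filter (· < u)) := by
    ext x
    simp only [Finset.mem_filter, Finset.mem_insert, le_iff_eq_or_lt]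
    grind
  rw [h, Finset.card_insert_of_notMem (by simp), posIn]

theorem posIn_lt_posIn_of_lt {V : Type*} [Fintype V] [LinearOrder V] {G : SimpleGraph V}
    (hco : ∀ u v w : V, u < v → v < w → ¬ G.Adj u v → ¬ G.Adj v w → ¬ G.Adj u w)
    {u v : V} (huv : u < v) (hnadj : ¬ G.Adj u v) {I J : Finset V}
    (hI : IsIndep G I) (hu : u ∈ I)
    (hJ : IsIndep G J) (hJcard : J.card = indepNum G) (hv : v ∈ J) :
    posIn I u < posIn J v := by
  have hle := (hI.union_filter hco huv hnadj hu hJ hv).card_le_indepNum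
  rw [Finset.card_union_of_disjoint, card_filter_le_eq_posIn hu, ← hJcard] at hle
  · have hsplit := J.card_filter_add_card_filter_not (· < v)
    simp only [not_lt] at hsplit
    have hpos : posIn J v = (J.filter (· < v)).card + 1 := rfl
    omega
  · rw [Finset.disjoint_left]
    intro x hx hx'
    exact absurd ((Finset.mem_filter.1 hx').2.trans (Finset.mem_filter.1 hx).2) huv.not_ge

/-- In a finite graph with a co-comparability ordering, if `u ≠ v`,
`uv ∉ E`, `I_u` is a maximum independent set containing `u` and `I_v` is a maximum
independent set containing `v`, then `pos_{I_u}(u) < pos_{I_v}(v)` iff `u ≺ v`. -/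
theorem stmt6 {V : Type*} [Fintype V] [LinearOrder V] (G : SimpleGraph V)
    (hco : ∀ u v w : V, u < v → v < w → ¬ G.Adj u v → ¬ G.Adj v w → ¬ G.Adj u w)
    (u v : V) (huv : u ≠ v) (hnadj : ¬ G.Adj u v) (Iu Iv : Finset V)
    (hIu : IsIndep G Iu) (hIucard : Iu.card = indepNum G) (huIu : u ∈ Iu)
    (hIv : IsIndep G Iv) (hIvcard : Iv.card = indepNum G) (hvIv : v ∈ Iv) :
    posIn Iu u < posIn Iv v ↔ u < v := by
  refine ⟨fun h => ?_, fun h => posIn_lt_posIn_of_lt hco h hnadj hIu huIu hIv hIvcard hvIv⟩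
  by_contra hlt
  exact h.not_gt (posIn_lt_posIn_of_lt hco (huv.lt_of_le' (not_lt.1 hlt))
    (fun hadj => hnadj hadj.symm) hIv hvIv hIu hIucard huIu)
end

section
/- Let G = (V,E) be a finite simple graph with a co-comparability ordering ≺, let v ∈ V, let β be the maximum cardinality of an independent set of G containing v, let I be an independent set of cardinality β containing v, and let p = pos_I(v). Then the maximum cardinality of a left extension of v equals p − 1, and the maximum cardinality of a right extension of v equals β − p. -/
/-- A left extension of `v`: an independent set all of whose vertices are
before `v` in the ordering and non-adjacent to `v`. -/
def IsLeftExt {V : Type*} [LinearOrder V] (G : SimpleGraph V) (v : V) (I : Finset V) : Prop :=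
  IsIndep G I ∧ ∀ u ∈ I, u < v ∧ ¬ G.Adj u v

/-- A right extension of `v`: an independent set all of whose vertices are
after `v` in the ordering and non-adjacent to `v`. -/
def IsRightExt {V : Type*} [LinearOrder V] (G : SimpleGraph V) (v : V) (I : Finset V) : Prop :=
  IsIndep G I ∧ ∀ u ∈ I, v < u ∧ ¬ G.Adj u v

/-- The maximum cardinality of a left extension of `v`. -/
noncomputable def leftExtNum {V : Type*} [LinearOrder V] (G : SimpleGraph V) (v : V) : ℕ :=
  sSup {n | ∃ I : Finset V, IsLeftExt G v I ∧ I.card = n}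

/-- The maximum cardinality of a right extension of `v`. -/
noncomputable def rightExtNum {V : Type*} [LinearOrder V] (G : SimpleGraph V) (v : V) : ℕ :=
  sSup {n | ∃ I : Finset V, IsRightExt G v I ∧ I.card = n}

/-- In a co-comparability ordering, a left and a right extension of `v` combine with `v`
to an independent set. -/
lemma IsLeftExt.isIndep_insert_union {V : Type*} [LinearOrder V] {G : SimpleGraph V}
    (hco : ∀ u v w : V, u < v → v < w → ¬ G.Adj u v → ¬ G.Adj v w → ¬ G.Adj u w)
    {v : V} {L R : Finset V} (hL : IsLeftExt G v L) (hR : IsRightExt G v R) :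
    IsIndep G (insert v (L ∪ R)) := by
  have hLR : ∀ a ∈ L, ∀ b ∈ R, ¬ G.Adj a b := fun a ha b hb =>
    hco a v b (hL.2 a ha).1 (hR.2 b hb).1 (hL.2 a ha).2 fun h => (hR.2 b hb).2 h.symm
  intro a ha b hb hab h
  simp only [Finset.mem_insert, Finset.mem_union] at ha hb
  rcases ha with rfl | ha | ha <;> rcases hb with rfl | hb | hb
  · exact hab rfl
  · exact (hL.2 b hb).2 h.symm
  · exact (hR.2 b hb).2 h.symm
  · exact (hL.2 a ha).2 h
  · exact hL.1 a ha b hb hab h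
  · exact hLR a ha b hb h
  · exact (hR.2 a ha).2 h
  · exact hLR b hb a ha h.symm
  · exact hR.1 a ha b hb hab h

lemma IsLeftExt.card_insert_union {V : Type*} [LinearOrder V] {G : SimpleGraph V}
    {v : V} {L R : Finset V} (hL : IsLeftExt G v L) (hR : IsRightExt G v R) :
    (insert v (L ∪ R)).card = L.card + R.card + 1 := by
  rw [Finset.card_insert_of_notMem, Finset.card_union_of_disjoint]
  · exact Finset.disjoint_left.2 fun a ha hb => lt_asymm (hL.2 a ha).1 (hR.2 a hb).1
  · intro h
    rcases Finset.mem_union.1 h with h | h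
    · exact lt_irrefl v (hL.2 v h).1
    · exact lt_irrefl v (hR.2 v h).1

lemma IsIndep.isLeftExt_filter_lt {V : Type*} [LinearOrder V] {G : SimpleGraph V}
    {v : V} {I : Finset V} (hI : IsIndep G I) (hv : v ∈ I) :
    IsLeftExt G v (I.filter fun u => u < v) := by
  simp only [IsLeftExt, IsIndep, Finset.mem_filter]
  exact ⟨fun a ha b hb => hI a ha.1 b hb.1, fun a ha => ⟨ha.2, hI a ha.1 v hv ha.2.ne⟩⟩

lemma IsIndep.isRightExt_filter_gt {V : Type*} [LinearOrder V] {G : SimpleGraph V}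
    {v : V} {I : Finset V} (hI : IsIndep G I) (hv : v ∈ I) :
    IsRightExt G v (I.filter fun u => v < u) := by
  simp only [IsRightExt, IsIndep, Finset.mem_filter]
  exact ⟨fun a ha b hb => hI a ha.1 b hb.1, fun a ha => ⟨ha.2, hI a ha.1 v hv ha.2.ne'⟩⟩

/-- In a finite graph with a co-comparability ordering, let `β` be the
maximum cardinality of an independent set containing `v`, let `I` be an independent set
of cardinality `β` containing `v` and `p = pos_I(v)`. Then the maximum cardinality of a
left extension of `v` is `p - 1` and the maximum cardinality of a right extension of `v`
is `β - p`. -/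
theorem stmt11 {V : Type*} [Fintype V] [LinearOrder V] (G : SimpleGraph V)
    (hco : ∀ u v w : V, u < v → v < w → ¬ G.Adj u v → ¬ G.Adj v w → ¬ G.Adj u w)
    (v : V) (β : ℕ) (I : Finset V)
    (hI : IsIndep G I) (hvI : v ∈ I) (hcard : I.card = β)
    (hβmax : ∀ J : Finset V, IsIndep G J → v ∈ J → J.card ≤ β)
    (p : ℕ) (hp : p = posIn I v) :
    leftExtNum G v = p - 1 ∧ rightExtNum G v = β - p := by
  have hL := hI.isLeftExt_filter_lt hvI
  have hR := hI.isRightExt_filter_gt hvI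
  have hsplit : insert v ((I.filter fun u => u < v) ∪ I.filter fun u => v < u) = I := by
    ext a
    simp only [Finset.mem_insert, Finset.mem_union, Finset.mem_filter]
    grind
  have hsum := hL.card_insert_union hR
  rw [hsplit, hcard] at hsum
  have hbound : ∀ L R : Finset V, IsLeftExt G v L → IsRightExt G v R →
      L.card + R.card + 1 ≤ β := fun L R hL hR =>
    hL.card_insert_union hR ▸
      hβmax _ (hL.isIndep_insert_union hco hR) (Finset.mem_insert_self v _)
  unfold posIn at hp
  constructor
  · refine IsGreatest.csSup_eq ⟨⟨_, hL, by omega⟩, ?_⟩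
    rintro _ ⟨L, hL', rfl⟩
    have := hbound L _ hL' hR
    omega
  · refine IsGreatest.csSup_eq ⟨⟨_, hR, by omega⟩, ?_⟩
    rintro _ ⟨R, hR', rfl⟩
    have := hbound _ R hL hR'
    omega
end
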